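/- Let X and Y be CAT(0) cube complexes with no extremal vertices, let f : ∂X → ∂Y be a Möbius bijection, and let x1, x2, x ∈ ∂X satisfy x1 op_x x2, with m_x := m(x1,x2,x) ∈ X and m'_x := m(f(x1),f(x2),f(x)) ∈ Y. If u, v ∈ ∂X are points such that the 4-tuples (x1,x2,u,v), (x1,x2,x,u) and (x1,x2,x,v) all lie in 𝒜(X), then (u·v)_{m_x} = (f(u)·f(v))_{m'_x}. -/

import Mathlib

/-!
We use the standard combinatorial model of a CAT(0) cube complex: it is identified
with its vertex set endowed with the combinatorial (ℓ¹) metric, i.e. with a median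
graph `G` on a vertex type `V`.  Halfspaces are realised as the vertex sets of the
two sides of the hyperplane dual to an edge, the Roller compactification `X̄` is the
set of ultrafilters of halfspaces, vertices embedding via principal ultrafilters,
and the Roller boundary `∂X` consists of the non-principal ultrafilters.
-/

open scoped ENNReal
open Set

namespace CCCR

variable {V V' : Type*}

/-- The interval between two vertices w.r.t. the combinatorial metric. -/
def vInterval (G : SimpleGraph V) (u v : V) : Set V :=
  {w : V | G.dist u w + G.dist w v = G.dist u v}

/-- Combinatorial model of a CAT(0) cube complex (identified with its vertex set,
endowed with the combinatorial metric): a connected median graph. -/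
def IsCCC (G : SimpleGraph V) : Prop :=
  G.Connected ∧ ∀ x y z : V, ∃! m : V,
    m ∈ vInterval G x y ∧ m ∈ vInterval G y z ∧ m ∈ vInterval G z x

/-- Halfspaces of the cube complex: the sides of the hyperplane dual to an edge. -/
def IsHalfspace (G : SimpleGraph V) (h : Set V) : Prop :=
  ∃ u v : V, G.Adj u v ∧ h = {w : V | G.dist w v < G.dist w u}

/-- The halfspace dual to the (oriented) edge `(u,v)` containing `v`. -/
def edgeHalf (G : SimpleGraph V) (u v : V) : Set V :=
  {w : V | G.dist w v < G.dist w u}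

/-- The hyperplane (wall) dual to the edge `(u,v)`, recorded as its pair of sides. -/
def wallOf (G : SimpleGraph V) (u v : V) : Set (Set V) :=
  {edgeHalf G u v, (edgeHalf G u v)ᶜ}

/-- Two (necessarily distinct) hyperplanes, with respective sides `h` and `k`,
are transverse: all four quarter-spaces are nonempty. -/
def Transv (h k : Set V) : Prop :=
  (h ∩ k).Nonempty ∧ (h ∩ kᶜ).Nonempty ∧ (hᶜ ∩ k).Nonempty ∧ (hᶜ ∩ kᶜ).Nonempty

/-- An ultrafilter of halfspaces: a point of the Roller compactification X̄.
It contains exactly one side of each hyperplane, and any two members intersect. -/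
def IsUltra (G : SimpleGraph V) (σ : Set (Set V)) : Prop :=
  (∀ h ∈ σ, IsHalfspace G h) ∧
  (∀ h : Set V, IsHalfspace G h → (h ∈ σ ↔ hᶜ ∉ σ)) ∧
  (∀ h ∈ σ, ∀ k ∈ σ, (h ∩ k).Nonempty)

/-- The principal ultrafilter of a vertex, i.e. the image of `v` in X̄. -/
def princ (G : SimpleGraph V) (v : V) : Set (Set V) :=
  {h : Set V | IsHalfspace G h ∧ v ∈ h}

/-- A point of the Roller boundary ∂X = X̄ ∖ X: a non-principal ultrafilter. -/
def IsBdryPt (G : SimpleGraph V) (σ : Set (Set V)) : Prop :=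
  IsUltra G σ ∧ ∀ v : V, σ ≠ princ G v

/-- The Roller boundary ∂X as a type. -/
abbrev Bdry (G : SimpleGraph V) : Type _ := {σ : Set (Set V) // IsBdryPt G σ}

/-- The Gromov product (x·y)_v = #𝒲(v | x, y) ∈ ℕ ∪ {+∞}, counted through the
sides containing both x and y but not v. -/
noncomputable def grom (_G : SimpleGraph V) (v : V) (x y : Set (Set V)) : ℕ∞ :=
  {h : Set V | h ∈ x ∧ h ∈ y ∧ v ∉ h}.encard

/-- The embedding ℕ ∪ {+∞} → ℤ ∪ {±∞}. -/
noncomputable def toE (n : ℕ∞) : EReal := ((n : ℝ≥0∞) : EReal)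

/-- The cross ratio cr_v(x,y,z,w) = (x·z)_v + (y·w)_v − (x·w)_v − (y·z)_v ∈ ℤ ∪ {±∞}. -/
noncomputable def crv (G : SimpleGraph V) (v : V) (x y z w : Set (Set V)) : EReal :=
  toE (grom G v x z) + toE (grom G v y w) - toE (grom G v x w) - toE (grom G v y z)

/-- The triple of sums of Gromov products attached to a 4-tuple. -/
noncomputable def tripod (G : SimpleGraph V) (v : V) (x y z w : Set (Set V)) :
    ℕ∞ × ℕ∞ × ℕ∞ :=
  (grom G v x y + grom G v z w, grom G v x z + grom G v y w, grom G v x w + grom G v y z)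

/-- (x,y,z,w) ∈ 𝒜 w.r.t. the basepoint v: at most one of the three sums is infinite. -/
def inA (G : SimpleGraph V) (v : V) (x y z w : Set (Set V)) : Prop :=
  ((tripod G v x y z w).1 ≠ ⊤ ∧ (tripod G v x y z w).2.1 ≠ ⊤) ∨
  ((tripod G v x y z w).1 ≠ ⊤ ∧ (tripod G v x y z w).2.2 ≠ ⊤) ∨
  ((tripod G v x y z w).2.1 ≠ ⊤ ∧ (tripod G v x y z w).2.2 ≠ ⊤)

/-- (x,y,z,w) ∈ 𝒜 (this is independent of the basepoint). -/
def memA (G : SimpleGraph V) (x y z w : Set (Set V)) : Prop :=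
  ∀ v : V, inA G v x y z w

/-- Two triples in (ℕ ∪ {+∞})³ are equivalent if they differ by adding a constant
n ∈ ℕ to all three entries. -/
def TripEquiv (p q : ℕ∞ × ℕ∞ × ℕ∞) : Prop :=
  (∃ n : ℕ, p.1 = q.1 + (n : ℕ∞) ∧ p.2.1 = q.2.1 + (n : ℕ∞) ∧ p.2.2 = q.2.2 + (n : ℕ∞)) ∨
  (∃ n : ℕ, q.1 = p.1 + (n : ℕ∞) ∧ q.2.1 = p.2.1 + (n : ℕ∞) ∧ q.2.2 = p.2.2 + (n : ℕ∞))

/-- crt(x,y,z,w) = ⟪a:b:c⟫ (the cross ratio triple is independent of the basepoint,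
so we require the equality of classes at every basepoint). -/
def crtEq (G : SimpleGraph V) (x y z w : Set (Set V)) (a b c : ℕ∞) : Prop :=
  ∀ v : V, TripEquiv (tripod G v x y z w) (a, b, c)

/-- The median of three points of X̄. -/
def med (x y z : Set (Set V)) : Set (Set V) := (x ∩ y) ∪ (y ∩ z) ∪ (z ∩ x)

/-- The interval I(x,y) ⊆ X̄ between two points of X̄. -/
def rInterval (G : SimpleGraph V) (x y : Set (Set V)) : Set (Set (Set V)) :=
  {σ : Set (Set V) | IsUltra G σ ∧ x ∩ y ⊆ σ}

/-- `Op G x y z` : x and y are opposite with respect to z, i.e. the median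
m = m(x,y,z) lies in X and I(x,y) = I(x,m) ∪ I(m,y). -/
def Op (G : SimpleGraph V) (x y z : Set (Set V)) : Prop :=
  (∃ p : V, med x y z = princ G p) ∧
  rInterval G x y = rInterval G x (med x y z) ∪ rInterval G (med x y z) y

/-- A geodesic ray (based at `r 0`). -/
def IsGeodRay (G : SimpleGraph V) (r : ℕ → V) : Prop :=
  (∀ n : ℕ, G.Adj (r n) (r (n + 1))) ∧
  ∀ m n : ℕ, m ≤ n → G.dist (r m) (r n) = n - m

/-- A bi-infinite geodesic line. -/
def IsGeodLine (G : SimpleGraph V) (L : ℤ → V) : Prop :=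
  (∀ n : ℤ, G.Adj (L n) (L (n + 1))) ∧
  ∀ m n : ℤ, m ≤ n → (G.dist (L m) (L n) : ℤ) = n - m

/-- The set 𝒲(r) of hyperplanes crossed by (the edges of) a ray. -/
def rayWalls (G : SimpleGraph V) (r : ℕ → V) : Set (Set (Set V)) :=
  {W : Set (Set V) | ∃ n : ℕ, W = wallOf G (r n) (r (n + 1))}

/-- A hyperplane is adjacent to `v` if it is dual to an edge incident to `v`. -/
def WallAdjTo (G : SimpleGraph V) (v : V) (W : Set (Set V)) : Prop :=
  ∃ u : V, G.Adj v u ∧ W = wallOf G v u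

/-- A straight ray: no two of the hyperplanes it crosses are transverse. -/
def RayStraight (G : SimpleGraph V) (r : ℕ → V) : Prop :=
  ∀ m n : ℕ, ¬ Transv (edgeHalf G (r m) (r (m + 1))) (edgeHalf G (r n) (r (n + 1)))

/-- A straight line: no two of the hyperplanes it crosses are transverse. -/
def LineStraight (G : SimpleGraph V) (L : ℤ → V) : Prop :=
  ∀ m n : ℤ, ¬ Transv (edgeHalf G (L m) (L (m + 1))) (edgeHalf G (L n) (L (n + 1)))

/-- The endpoint at infinity r⁺ ∈ ∂X of a ray: the ultrafilter of those halfspaces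
containing all but finitely many of its vertices. -/
def rayEnd (G : SimpleGraph V) (r : ℕ → V) : Set (Set V) :=
  {h : Set V | IsHalfspace G h ∧ ∃ N : ℕ, ∀ n : ℕ, N ≤ n → r n ∈ h}

/-- A straight point of the Roller boundary: the endpoint at infinity of a straight ray. -/
def IsStraightPt (G : SimpleGraph V) (x : Set (Set V)) : Prop :=
  ∃ r : ℕ → V, IsGeodRay G r ∧ RayStraight G r ∧ rayEnd G r = x

/-- x and y are the two endpoints at infinity of the line L. -/
def LineEnds (G : SimpleGraph V) (L : ℤ → V) (x y : Set (Set V)) : Prop :=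
  rayEnd G (fun n : ℕ => L (n : ℤ)) = x ∧ rayEnd G (fun n : ℕ => L (-(n : ℤ))) = y

/-- The edges from `v` to `a` and from `v` to `b` span a square. -/
def SpansSquare (G : SimpleGraph V) (v a b : V) : Prop :=
  ∃ w : V, w ≠ v ∧ G.Adj a w ∧ G.Adj b w

/-- An extremal vertex: some edge at `v` spans a square with every other edge at `v`. -/
def Extremal (G : SimpleGraph V) (v : V) : Prop :=
  ∃ a : V, G.Adj v a ∧ ∀ b : V, G.Adj v b → b ≠ a → SpansSquare G v a b

/-- The cube complex has no extremal vertices. -/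
def NoExtremal (G : SimpleGraph V) : Prop := ∀ v : V, ¬ Extremal G v

/-- A skinny vertex: exactly two incident edges. -/
def Skinny (G : SimpleGraph V) (v : V) : Prop := {u : V | G.Adj v u}.encard = 2

/-- A skinny ray: a geodesic ray whose initial vertex has at least three incident
edges and all of whose other vertices are skinny. -/
def IsSkinnyRay (G : SimpleGraph V) (r : ℕ → V) : Prop :=
  IsGeodRay G r ∧ 3 ≤ {u : V | G.Adj (r 0) u}.encard ∧ ∀ n : ℕ, 1 ≤ n → Skinny G (r n)

/-- (The vertex set of) a cube of the complex: a subset inducing a hypercube graph. -/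
def IsCube (G : SimpleGraph V) (c : Set V) : Prop :=
  ∃ (n : ℕ) (e : c ≃ (Fin n → Bool)),
    ∀ a b : c, G.Adj (a : V) (b : V) ↔ ∃! i : Fin n, e a i ≠ e b i

/-- A maximal cube. -/
def IsMaxCube (G : SimpleGraph V) (c : Set V) : Prop :=
  IsCube G c ∧ ∀ c' : Set V, IsCube G c' → c ⊆ c' → c' = c

/-- Completeness: there is no infinite ascending chain of cubes. -/
def CubeComplete (G : SimpleGraph V) : Prop :=
  ¬ ∃ c : ℕ → Set V, (∀ n : ℕ, IsCube G (c n)) ∧ ∀ n : ℕ, c n ⊂ c (n + 1)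

/-- No free faces: no non-maximal cube is contained in a unique maximal cube. -/
def NoFreeFaces (G : SimpleGraph V) : Prop :=
  ∀ c : Set V, IsCube G c → ¬ IsMaxCube G c → ¬ ∃! m : Set V, IsMaxCube G m ∧ c ⊆ m

/-- #𝒲(x, z | y, w): the number of hyperplanes separating x and z from y and w,
counted through the sides containing x and z. -/
noncomputable def sepCount (x z y w : Set (Set V)) : ℕ∞ :=
  {h : Set V | h ∈ x ∧ h ∈ z ∧ h ∉ y ∧ h ∉ w}.encard

/-- A Möbius map between Roller boundaries: it maps 𝒜(X) into 𝒜(Y) and preserves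
cross ratios. -/
def Mobius (G : SimpleGraph V) (G' : SimpleGraph V') (f : Bdry G → Bdry G') : Prop :=
  ∀ x y z w : Bdry G, memA G x.1 y.1 z.1 w.1 →
    memA G' (f x).1 (f y).1 (f z).1 (f w).1 ∧
    ∀ (v : V) (v' : V'),
      crv G' v' (f x).1 (f y).1 (f z).1 (f w).1 = crv G v x.1 y.1 z.1 w.1

/-- The induced action of a cubical isomorphism on X̄: an ultrafilter is mapped to
the set of images of its halfspaces. -/
def mapUltra (φ : V → V') (σ : Set (Set V)) : Set (Set V') :=
  (fun h : Set V => φ '' h) '' σ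

/-- The standard cubulation of ℝ: vertex set ℤ, edges between consecutive integers. -/
def zline : SimpleGraph ℤ := SimpleGraph.fromRel (fun m n => n = m + 1)

end CCCR

namespace CCCR

section Infra

variable {W : Type*} {G : SimpleGraph W}

lemma adj_dist (hG : IsCCC G) {u v : W} (h : G.Adj u v) (w : W) :
    G.dist w v = G.dist w u + 1 ∨ G.dist w u = G.dist w v + 1 := by
  obtain ⟨m, ⟨h1, h2, h3⟩, -⟩ := hG.2 u v w
  simp only [vInterval, mem_ofPred_eq] at h1 h2 h3
  have huv : G.dist u v = 1 := SimpleGraph.dist_eq_one_iff_adj.mpr h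
  rw [huv] at h1
  have e1 := G.dist_comm (u := v) (v := w)
  have e2 := G.dist_comm (u := m) (v := w)
  have e3 := G.dist_comm (u := m) (v := u)
  have e4 := G.dist_comm (u := m) (v := v)
  have hc := hG.1
  rcases Nat.eq_zero_or_pos (G.dist u m) with h0 | h0
  · have : u = m := (hc.dist_eq_zero_iff).mp h0
    subst this
    left; omega
  · have h0' : G.dist m v = 0 := by omega
    have : m = v := (hc.dist_eq_zero_iff).mp h0'
    subst this
    right; omega

lemma compl_edgeHalf (hG : IsCCC G) {u v : W} (h : G.Adj u v) :
    (edgeHalf G u v)ᶜ = edgeHalf G v u := by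
  ext w
  simp only [edgeHalf, mem_compl_iff, mem_ofPred_eq]
  have := adj_dist hG h w
  omega

lemma isHalf_edge {u v : W} (h : G.Adj u v) : IsHalfspace G (edgeHalf G u v) :=
  ⟨u, v, h, rfl⟩

lemma isHalf_compl (hG : IsCCC G) {h : Set W} (hh : IsHalfspace G h) : IsHalfspace G hᶜ := by
  obtain ⟨u, v, huv, rfl⟩ := hh
  refine ⟨v, u, huv.symm, ?_⟩
  exact compl_edgeHalf hG huv

lemma mem_edgeHalf_right {u v : W} (h : G.Adj u v) : v ∈ edgeHalf G u v := by
  simp [edgeHalf, SimpleGraph.dist_eq_one_iff_adj.mpr h.symm]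

lemma not_mem_edgeHalf_left {u v : W} : u ∉ edgeHalf G u v := by
  simp [edgeHalf]

/-- quadrangle condition -/
lemma quad (hG : IsCCC G) {v a b z : W} (ha : G.Adj v a) (hb : G.Adj v b) (hab : a ≠ b)
    (hza : G.dist z a < G.dist z v) (hzb : G.dist z b < G.dist z v) :
    ∃ c, G.Adj a c ∧ G.Adj b c ∧ G.dist z c + 1 = G.dist z a ∧ c ≠ v := by
  have hc := hG.1
  have h1 := adj_dist hG ha z
  have h2 := adj_dist hG hb z
  obtain ⟨m, ⟨m1, m2, m3⟩, -⟩ := hG.2 a b z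
  simp only [vInterval, mem_ofPred_eq] at m1 m2 m3
  have e1 := G.dist_comm (u := b) (v := z)
  have e2 := G.dist_comm (u := m) (v := z)
  have e3 := G.dist_comm (u := m) (v := a)
  have e4 := G.dist_comm (u := m) (v := b)
  have e5 := G.dist_comm (u := a) (v := v)
  have hva : G.dist v a = 1 := SimpleGraph.dist_eq_one_iff_adj.mpr ha
  have hvb : G.dist v b = 1 := SimpleGraph.dist_eq_one_iff_adj.mpr hb
  have htri := hc.dist_triangle (u := a) (v := v) (w := b)
  have hpos := hc.pos_dist_of_ne hab
  have q1 : G.dist a m = 1 := by omega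
  have q2 : G.dist b m = 1 := by omega
  refine ⟨m, SimpleGraph.dist_eq_one_iff_adj.mp q1, SimpleGraph.dist_eq_one_iff_adj.mp q2,
    by omega, ?_⟩
  rintro rfl
  omega

lemma dist_two (hG : IsCCC G) {a b c : W} (h1 : G.Adj a b) (h2 : G.Adj a c) (hne : b ≠ c) :
    G.dist b c = 2 := by
  have hc := hG.1
  have h3 := adj_dist hG h2 b
  have : G.dist b a = 1 := SimpleGraph.dist_eq_one_iff_adj.mpr h1.symm
  have := hc.pos_dist_of_ne hne
  omega

lemma square_sub (hG : IsCCC G) {a b a' b' : W} (hab : G.Adj a b) (haa : G.Adj a a')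
    (hbb : G.Adj b b') (hab' : G.Adj a' b') (h1 : b ≠ a') (hne : a ≠ b') :
    edgeHalf G a' b' ⊆ edgeHalf G a b := by
  intro w hw
  by_contra hcon
  simp only [edgeHalf, mem_ofPred_eq] at hw hcon
  have hc := hG.1
  have d1 := adj_dist hG hab w
  have d2 := adj_dist hG haa w
  have d3 := adj_dist hG hbb w
  have d4 := adj_dist hG hab' w
  obtain ⟨m, hm1, hm2, hm3, hm4⟩ := quad hG hab.symm hbb hne
    (by omega : G.dist w a < G.dist w b) (by omega)
  have hma' : m ≠ a' := by rintro rfl; omega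
  obtain ⟨c, -, hu⟩ := hG.2 b a' m
  have u1 := hu a ⟨by
    simp [vInterval, dist_two hG hab haa h1, SimpleGraph.dist_eq_one_iff_adj.mpr hab.symm,
      SimpleGraph.dist_eq_one_iff_adj.mpr haa], by
    simp [vInterval, dist_two hG haa hm1 hma'.symm, SimpleGraph.dist_eq_one_iff_adj.mpr haa.symm,
      SimpleGraph.dist_eq_one_iff_adj.mpr hm1], by
    simp [vInterval, dist_two hG hm1 hab hm4, SimpleGraph.dist_eq_one_iff_adj.mpr hm1.symm,
      SimpleGraph.dist_eq_one_iff_adj.mpr hab]⟩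
  have u2 := hu b' ⟨by
    simp [vInterval, dist_two hG hab haa h1, SimpleGraph.dist_eq_one_iff_adj.mpr hbb,
      SimpleGraph.dist_eq_one_iff_adj.mpr hab'.symm], by
    simp [vInterval, dist_two hG haa hm1 hma'.symm, SimpleGraph.dist_eq_one_iff_adj.mpr hab',
      SimpleGraph.dist_eq_one_iff_adj.mpr hm2], by
    simp [vInterval, dist_two hG hm1 hab hm4, SimpleGraph.dist_eq_one_iff_adj.mpr hm2.symm,
      SimpleGraph.dist_eq_one_iff_adj.mpr hbb.symm]⟩
  exact hne (u1.trans u2.symm)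

lemma square_eq (hG : IsCCC G) {a b a' b' : W} (hab : G.Adj a b) (haa : G.Adj a a')
    (hbb : G.Adj b b') (hab' : G.Adj a' b') (h1 : b ≠ a') (h2 : a ≠ b') :
    edgeHalf G a' b' = edgeHalf G a b :=
  (square_sub hG hab haa hbb hab' h1 h2).antisymm
    (square_sub hG hab' haa.symm hbb.symm hab h2.symm h1.symm)

lemma exists_step (hG : IsCCC G) {a u : W} (hne : a ≠ u) :
    ∃ a', G.Adj a a' ∧ G.dist a' u + 1 = G.dist a u := by
  obtain ⟨p, hp⟩ := hG.1.exists_walk_length_eq_dist a u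
  cases p with
  | nil => exact absurd rfl hne
  | cons h q =>
    rename_i a'
    refine ⟨a', h, ?_⟩
    have h1 : G.dist a' u ≤ q.length := SimpleGraph.dist_le q
    simp only [SimpleGraph.Walk.length_cons] at hp
    have h2 := adj_dist hG h u
    have e1 := G.dist_comm (u := u) (v := a)
    have e2 := G.dist_comm (u := u) (v := a')
    omega

lemma djok_aux (hG : IsCCC G) {u v : W} (huv : G.Adj u v) (k : ℕ) : ∀ a b : W, G.Adj a b →
    b ∈ edgeHalf G u v → a ∉ edgeHalf G u v → G.dist a u = k →
    edgeHalf G a b = edgeHalf G u v := by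
  have hc := hG.1
  induction k with
  | zero =>
    intro a b hab hb ha hk
    have : a = u := hc.dist_eq_zero_iff.mp hk
    subst this
    simp only [edgeHalf, mem_ofPred_eq] at hb
    have : G.dist b a = 1 := SimpleGraph.dist_eq_one_iff_adj.mpr hab.symm
    have h0 : G.dist b v = 0 := by omega
    have : b = v := hc.dist_eq_zero_iff.mp h0
    rw [this]
  | succ k ih =>
    intro a b hab hb ha hk
    have hb' := hb
    have ha' := ha
    simp only [edgeHalf, mem_ofPred_eq] at hb ha
    have d1 := adj_dist hG huv a
    have d2 := adj_dist hG huv b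
    have d3 := adj_dist hG hab u
    have d4 := adj_dist hG hab v
    rw [G.dist_comm (u := u) (v := a), G.dist_comm (u := u) (v := b)] at d3
    rw [G.dist_comm (u := v) (v := a), G.dist_comm (u := v) (v := b)] at d4
    have hne : a ≠ u := by
      rintro rfl
      simp at hk
    obtain ⟨a', haa, hd⟩ := exists_step hG hne
    have d5 := adj_dist hG huv a'
    have d6 := adj_dist hG haa v
    rw [G.dist_comm (u := v) (v := a), G.dist_comm (u := v) (v := a')] at d6
    have hba : b ≠ a' := by rintro rfl; omega
    obtain ⟨b', q1, q2, q3, q4⟩ := quad hG hab haa hba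
      (z := v) (by
        rw [G.dist_comm (u := v) (v := a), G.dist_comm (u := v) (v := b)]; omega) (by
        rw [G.dist_comm (u := v) (v := a), G.dist_comm (u := v) (v := a')]; omega)
    rw [G.dist_comm (u := v) (v := b'), G.dist_comm (u := v) (v := b)] at q3
    have d7 := adj_dist hG huv b'
    have d8 := adj_dist hG q1 u
    rw [G.dist_comm (u := u) (v := b), G.dist_comm (u := u) (v := b')] at d8
    have := ih a' b' q2 (by simp only [edgeHalf, mem_ofPred_eq]; omega)
      (by simp only [edgeHalf, mem_ofPred_eq]; omega) (by omega)
    rw [← this]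
    exact (square_eq hG hab haa q1 q2 hba q4.symm).symm

lemma djok (hG : IsCCC G) {h : Set W} (hh : IsHalfspace G h) {a b : W} (hab : G.Adj a b)
    (hb : b ∈ h) (ha : a ∉ h) : edgeHalf G a b = h := by
  obtain ⟨u, v, huv, rfl⟩ := hh
  exact djok_aux hG huv _ a b hab hb ha rfl

lemma half_convex (hG : IsCCC G) {h : Set W} (hh : IsHalfspace G h) {z2 c : W} (h2 : z2 ∈ h)
    (n : ℕ) : ∀ z1 ∈ h, G.dist z1 c = n → G.dist z1 c + G.dist c z2 = G.dist z1 z2 → c ∈ h := by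
  have hc := hG.1
  induction n with
  | zero =>
    intro z1 h1 h0 _
    rwa [← hc.dist_eq_zero_iff.mp h0]
  | succ n ih =>
    intro z1 h1 hn hI
    have hne : z1 ≠ c := by
      rintro rfl
      simp at hn
    obtain ⟨z, hz, hd⟩ := exists_step hG hne
    have t := hc.dist_triangle (u := z) (v := c) (w := z2)
    have ad := adj_dist hG hz z2
    rw [G.dist_comm (u := z2) (v := z1), G.dist_comm (u := z2) (v := z)] at ad
    by_cases hzh : z ∈ h
    · exact ih z hzh (by omega) (by omega)
    · have := djok hG hh hz.symm h1 hzh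
      rw [← this] at h2
      simp only [edgeHalf, mem_ofPred_eq] at h2
      rw [G.dist_comm (u := z2) (v := z1), G.dist_comm (u := z2) (v := z)] at h2
      omega

/-- a halfspace not containing `m` lies in a halfspace dual to an edge at `m`. -/
lemma exists_adj_half (hG : IsCCC G) {h : Set W} (hh : IsHalfspace G h) {m : W} (hm : m ∉ h) :
    ∃ b, G.Adj m b ∧ h ⊆ edgeHalf G m b := by
  have hc := hG.1
  have hne : h.Nonempty := by
    obtain ⟨u, v, huv, rfl⟩ := hh
    exact ⟨v, mem_edgeHalf_right huv⟩
  obtain ⟨v, hv, hmin⟩ : ∃ v ∈ h, ∀ z ∈ h, G.dist m v ≤ G.dist m z := by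
    classical
    have hex : ∃ n, ∃ v ∈ h, G.dist m v = n := ⟨_, hne.some, hne.some_mem, rfl⟩
    obtain ⟨v, hv, he⟩ := Nat.find_spec hex
    refine ⟨v, hv, fun z hz => ?_⟩
    rw [he]
    exact Nat.find_min' hex ⟨z, hz, rfl⟩
  have hmv : m ≠ v := by rintro rfl; exact hm hv
  obtain ⟨b, hb, hd⟩ := exists_step hG hmv
  refine ⟨b, hb, fun z hz => ?_⟩
  obtain ⟨c, ⟨c1, c2, c3⟩, -⟩ := hG.2 m v z
  simp only [vInterval, mem_ofPred_eq] at c1 c2 c3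
  have hch := half_convex hG hh hz _ v hv rfl c2
  have := hmin c hch
  have h0 : G.dist c v = 0 := by omega
  have : c = v := hc.dist_eq_zero_iff.mp h0
  subst this
  have t := hc.dist_triangle (u := z) (v := c) (w := b)
  have ad := adj_dist hG hb z
  simp only [edgeHalf, mem_ofPred_eq]
  rw [G.dist_comm (u := c) (v := b)] at t
  rw [G.dist_comm (u := c) (v := m)] at c3
  omega

lemma ultra_up (hG : IsCCC G) {σ : Set (Set W)} (hσ : IsUltra G σ) {h k : Set W} (hh : h ∈ σ)
    (hk : IsHalfspace G k) (hhk : h ⊆ k) : k ∈ σ := by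
  rw [hσ.2.1 k hk]
  intro hkc
  obtain ⟨z, hz1, hz2⟩ := hσ.2.2 h hh _ hkc
  exact hz2 (hhk hz1)

lemma princ_ultra (hG : IsCCC G) (z : W) : IsUltra G (princ G z) := by
  refine ⟨fun h hh => hh.1, fun h hh => ?_, fun h hh k hk => ⟨z, hh.2, hk.2⟩⟩
  simp [princ, hh, isHalf_compl hG hh]

lemma med_ultra {x y z : Set (Set W)} (hx : IsUltra G x) (hy : IsUltra G y) (hz : IsUltra G z) :
    IsUltra G (med x y z) := by
  refine ⟨?_, ?_, ?_⟩
  · rintro h ((hh | hh) | hh)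
    · exact hx.1 h hh.1
    · exact hy.1 h hh.1
    · exact hz.1 h hh.1
  · intro h hh
    have h1 := hx.2.1 h hh
    have h2 := hy.2.1 h hh
    have h3 := hz.2.1 h hh
    simp only [med, mem_union, mem_inter_iff]
    tauto
  · rintro h ((hh | hh) | hh) k ((hk | hk) | hk)
    · exact hx.2.2 h hh.1 k hk.1
    · exact hy.2.2 h hh.2 k hk.1
    · exact hx.2.2 h hh.1 k hk.2
    · exact hy.2.2 h hh.1 k hk.2
    · exact hy.2.2 h hh.1 k hk.1
    · exact hz.2.2 h hh.2 k hk.1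
    · exact hx.2.2 h hh.2 k hk.1
    · exact hz.2.2 h hh.1 k hk.2
    · exact hz.2.2 h hh.1 k hk.1

/-- Consequence of opposition: halfspaces towards `x1` and `x2` are disjoint. -/
lemma op_disj (hG : IsCCC G) {x1 x2 x : Set (Set W)} (h1 : IsUltra G x1) (h2 : IsUltra G x2)
    (hop : Op G x1 x2 x) {p : W} (hp : med x1 x2 x = princ G p)
    {h k : Set W} (hh : h ∈ x1) (hk : k ∈ x2) (hph : p ∉ h) (hpk : p ∉ k) :
    ∀ z, z ∈ h → z ∈ k → False := by
  intro z hzh hzk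
  have hz := princ_ultra hG z
  have hσ : IsUltra G (med x1 x2 (princ G z)) := med_ultra h1 h2 hz
  have hmem : med x1 x2 (princ G z) ∈ rInterval G x1 x2 :=
    ⟨hσ, fun a ha => Or.inl (Or.inl ha)⟩
  have hhH := h1.1 h hh
  have hkH := h2.1 k hk
  have hσh : h ∈ med x1 x2 (princ G z) := Or.inr ⟨⟨hhH, hzh⟩, hh⟩
  have hσk : k ∈ med x1 x2 (princ G z) := Or.inl (Or.inr ⟨hk, ⟨hkH, hzk⟩⟩)
  rw [hop.2, hp] at hmem
  rcases hmem with hm | hm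
  · have hk1 : k ∉ x1 := fun hk1 => by
      have : k ∈ med x1 x2 x := Or.inl (Or.inl ⟨hk1, hk⟩)
      rw [hp] at this
      exact hpk this.2
    have hkc : kᶜ ∈ x1 := by
      have := h1.2.1 k hkH
      tauto
    have := hm.2 ⟨hkc, isHalf_compl hG hkH, hpk⟩
    exact (hσ.2.1 k hkH).1 hσk this
  · have hh2 : h ∉ x2 := fun hh2 => by
      have : h ∈ med x1 x2 x := Or.inl (Or.inl ⟨hh, hh2⟩)
      rw [hp] at this
      exact hph this.2
    have hhc : hᶜ ∈ x2 := by
      have := h2.2.1 h hhH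
      tauto
    have := hm.2 ⟨⟨isHalf_compl hG hhH, hph⟩, hhc⟩
    exact (hσ.2.1 h hhH).1 hσh this

lemma nonsq_disj (hG : IsCCC G) {v a b : W} (ha : G.Adj v a) (hb : G.Adj v b) (hab : b ≠ a)
    (hns : ¬ SpansSquare G v a b) {z : W} (h1 : z ∈ edgeHalf G v a) (h2 : z ∈ edgeHalf G v b) :
    False := by
  obtain ⟨c, c1, c2, -, c4⟩ := quad hG ha hb hab.symm h1 h2
  exact hns ⟨c, c4, c1, c2⟩

/-- From an edge, an edge pointing away. -/
lemma exists_away (hG : IsCCC G) (hne : NoExtremal G) {v a : W} (ha : G.Adj v a) :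
    ∃ b, G.Adj v b ∧ b ≠ a ∧ ∀ z ∈ edgeHalf G v b, z ∉ edgeHalf G v a := by
  have := hne v
  simp only [Extremal, not_exists, not_and, not_forall] at this
  obtain ⟨b, hb, hba, hns⟩ := this a ha
  exact ⟨b, hb, hba, fun z h2 h1 => nonsq_disj hG ha hb hba hns h1 h2⟩

/-- Endpoint of a straight ray starting with the edge `(q,b)`. -/
lemma straight_end (hG : IsCCC G) (hne : NoExtremal G) {q b : W} (hqb : G.Adj q b) :
    ∃ t : Set (Set W), IsBdryPt G t ∧ edgeHalf G q b ∈ t ∧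
      ∀ h ∈ t, q ∉ h → h ⊆ edgeHalf G q b := by
  classical
  have hstep : ∀ e : {e : W × W // G.Adj e.1 e.2}, ∃ e' : {e : W × W // G.Adj e.1 e.2},
      e'.1.1 = e.1.2 ∧ edgeHalf G e'.1.1 e'.1.2 ⊆ edgeHalf G e.1.1 e.1.2 := by
    rintro ⟨⟨a, c⟩, hac⟩
    obtain ⟨d, hd, -, hz⟩ := exists_away hG hne hac.symm
    refine ⟨⟨(c, d), hd⟩, rfl, fun z hzz => ?_⟩
    have := hz z hzz
    rw [← compl_edgeHalf hG hac] at this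
    simpa using this
  choose F hF1 hF2 using hstep
  let E : ℕ → {e : W × W // G.Adj e.1 e.2} := fun n => F^[n] ⟨(q, b), hqb⟩
  have hE : ∀ n, E (n + 1) = F (E n) := fun n => Function.iterate_succ_apply' F n _
  let r : ℕ → W := fun n => (E n).1.1
  have hr1 : ∀ n, r (n + 1) = (E n).1.2 := fun n => by
    show (E (n + 1)).1.1 = _
    rw [hE, hF1]
  let K : ℕ → Set W := fun n => edgeHalf G (r n) (r (n + 1))
  have hadj : ∀ n, G.Adj (r n) (r (n + 1)) := fun n => by
    rw [hr1]; exact (E n).2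
  have hKE : ∀ n, K n = edgeHalf G (E n).1.1 (E n).1.2 := fun n => by
    show edgeHalf G (r n) (r (n + 1)) = _
    rw [hr1]
  have hKs : ∀ n, K (n + 1) ⊆ K n := fun n => by
    rw [hKE, hKE, hE]; exact hF2 _
  have hKa : Antitone K := antitone_nat_of_succ_le hKs
  have hr0 : r 0 = q := rfl
  have hK0 : K 0 = edgeHalf G q b := by rw [hKE]; rfl
  have hin : ∀ i n, i < n → r n ∈ K i := fun i n hi => by
    obtain ⟨m, rfl⟩ : ∃ m, n = m + 1 := ⟨n - 1, by omega⟩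
    exact hKa (by omega : i ≤ m) (mem_edgeHalf_right (hadj m))
  have hKH : ∀ n, IsHalfspace G (K n) := fun n => isHalf_edge (hadj n)
  -- crossing
  have hcross : ∀ h : Set W, IsHalfspace G h → ∀ i j, i < j → r i ∉ h → r j ∈ h →
      ∃ n, h = K n := by
    intro h hh i j hij hi hj
    by_contra hcon
    push Not at hcon
    have : ∀ n, r (i + n) ∉ h := fun n => by
      induction n with
      | zero => exact hi
      | succ n ih => exact fun hmem => hcon _ (djok hG hh (hadj (i + n)) hmem ih).symm
    exact this (j - i) (by rwa [Nat.add_sub_cancel' hij.le])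
  have hKt : ∀ n, K n ∈ rayEnd G r := fun n => ⟨hKH n, n + 1, fun m hm => hin n m (by omega)⟩
  have hinter : ∀ h ∈ rayEnd G r, ∀ k ∈ rayEnd G r, (h ∩ k).Nonempty := by
    rintro h ⟨-, N, hN⟩ k ⟨-, M, hM⟩
    exact ⟨r (max N M), hN _ (le_max_left _ _), hM _ (le_max_right _ _)⟩
  refine ⟨rayEnd G r, ⟨⟨fun h hh => hh.1, fun h hh => ⟨fun h1 h2 => ?_, fun h1 => ?_⟩, hinter⟩,
    fun v hv => ?_⟩, hK0 ▸ hKt 0, fun h hh hq => ?_⟩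
  · obtain ⟨z, hz1, hz2⟩ := hinter _ h1 _ h2
    exact hz2 hz1
  · by_cases hex : ∃ n, h = K n
    · obtain ⟨n, rfl⟩ := hex
      exact hKt n
    · by_cases hex' : ∃ n, hᶜ = K n
      · obtain ⟨n, hn⟩ := hex'
        rw [hn] at h1
        exact absurd (hKt n) h1
      · by_cases h0 : r 0 ∈ h
        · refine ⟨hh, 0, fun n _ => ?_⟩
          by_contra hn
          rcases Nat.eq_zero_or_pos n with rfl | hpos
          · exact hn h0
          · exact hex' (hcross _ (isHalf_compl hG hh) 0 n hpos (by simpa using h0) hn)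
        · exfalso
          apply h1
          refine ⟨isHalf_compl hG hh, 0, fun n _ => ?_⟩
          intro hn
          rcases Nat.eq_zero_or_pos n with rfl | hpos
          · exact h0 hn
          · exact hex (hcross _ hh 0 n hpos h0 hn)
  · have hall : ∀ n, v ∈ K n := fun n => by
      have := hKt n
      rw [hv] at this
      exact this.2
    have hdec : ∀ n, G.dist v (r n) + n ≤ G.dist v (r 0) := fun n => by
      induction n with
      | zero => simp
      | succ n ih =>
        have : G.dist v (r (n + 1)) < G.dist v (r n) := hall n
        omega
    have := hdec (G.dist v (r 0) + 1)
    omega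
  · obtain ⟨hH, N, hN⟩ := hh
    have hN1 := hN (N + 1) (by omega)
    obtain ⟨n, rfl⟩ := hcross h hH 0 (N + 1) (by omega) hq hN1
    rw [← hK0]
    exact hKa (Nat.zero_le n)

lemma grom_comm (v : W) (x y : Set (Set W)) : grom G v x y = grom G v y x := by
  unfold grom
  congr 1
  ext h
  simp only [mem_ofPred_eq]
  tauto

lemma grom_zero_iff {v : W} {x y : Set (Set W)} :
    grom G v x y = 0 ↔ ∀ h, h ∈ x → h ∈ y → v ∈ h := by
  unfold grom
  rw [Set.encard_eq_zero, Set.eq_empty_iff_forall_notMem]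
  simp only [mem_ofPred_eq, not_and, not_not]

lemma grom_fin_step (hG : IsCCC G) {x y : Set (Set W)} (hx : IsUltra G x) {v v' : W}
    (hv : G.Adj v v') (h : grom G v x y ≠ ⊤) : grom G v' x y ≠ ⊤ := by
  unfold grom at *
  rw [Set.encard_ne_top_iff] at *
  refine (h.union (Set.finite_singleton (edgeHalf G v' v))).subset ?_
  rintro k ⟨k1, k2, k3⟩
  by_cases hk : v ∈ k
  · right
    exact (djok hG (hx.1 k k1) hv.symm hk k3).symm
  · left
    exact ⟨k1, k2, hk⟩

lemma grom_fin (hG : IsCCC G) {x y : Set (Set W)} (hx : IsUltra G x) {v : W}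
    (h : grom G v x y ≠ ⊤) (v' : W) : grom G v' x y ≠ ⊤ := by
  obtain ⟨p⟩ := hG.1 v v'
  induction p with
  | nil => exact h
  | cons hadj p ih => exact ih (grom_fin_step hG hx hadj h)

lemma med_zero {x y z : Set (Set W)} {p : W} (hp : med x y z = princ G p) :
    grom G p x y = 0 ∧ grom G p y z = 0 ∧ grom G p x z = 0 := by
  simp only [grom_zero_iff]
  refine ⟨fun h a b => ?_, fun h a b => ?_, fun h a b => ?_⟩
  · have : h ∈ med x y z := Or.inl (Or.inl ⟨a, b⟩)
    rw [hp] at this; exact this.2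
  · have : h ∈ med x y z := Or.inl (Or.inr ⟨a, b⟩)
    rw [hp] at this; exact this.2
  · have : h ∈ med x y z := Or.inr ⟨b, a⟩
    rw [hp] at this; exact this.2

lemma exists_adj_of_pos (hG : IsCCC G) {x y : Set (Set W)} (hx : IsUltra G x) (hy : IsUltra G y)
    {p : W} (h : grom G p x y ≠ 0) :
    ∃ b, G.Adj p b ∧ edgeHalf G p b ∈ x ∧ edgeHalf G p b ∈ y := by
  rw [Ne, grom_zero_iff] at h
  push Not at h
  obtain ⟨k, k1, k2, k3⟩ := h
  obtain ⟨b, hb, hs⟩ := exists_adj_half hG (hx.1 k k1) k3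
  exact ⟨b, hb, ultra_up hG hx k1 (isHalf_edge hb) hs, ultra_up hG hy k2 (isHalf_edge hb) hs⟩

end Infra

end CCCR
namespace CCCR

section Main

variable {W : Type*} {G : SimpleGraph W}

/-- The auxiliary point `t`. -/
lemma exists_t (hG : IsCCC G) (hne : NoExtremal G) {x1 x2 x w : Set (Set W)}
    (h1 : IsUltra G x1) (h2 : IsUltra G x2) (hx : IsUltra G x) (hw : IsUltra G w)
    {p : W} (hdisj : ∀ h ∈ x1, ∀ k ∈ x2, p ∉ h → p ∉ k → ∀ z, z ∈ h → z ∈ k → False)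
    (h12 : grom G p x1 x2 = 0) (h1x : grom G p x1 x = 0)
    (hw1 : grom G p w x1 ≠ 0) (hwx : grom G p w x ≠ 0) :
    ∃ t : Set (Set W), IsBdryPt G t ∧ ∃ q : W, grom G q t w = 0 ∧ grom G q t x = 0 ∧
      grom G q t x2 = 0 := by
  obtain ⟨b, hb, hbw, hbx⟩ := exists_adj_of_pos hG hw hx hwx
  obtain ⟨c, hc, hcw, hcx⟩ := exists_adj_of_pos hG hw h1 hw1
  rw [grom_zero_iff] at h12 h1x
  have hbc : b ≠ c := by
    rintro rfl
    exact not_mem_edgeHalf_left (h1x _ hcx hbx)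
  obtain ⟨z, hz1, hz2⟩ := hw.2.2 _ hbw _ hcw
  obtain ⟨d, d1, d2, -, d4⟩ := quad hG hb hc hbc hz1 hz2
  -- the square p, b, c, d; work at c, with edge (c,d) parallel to (p,b)
  have hpar : edgeHalf G c d = edgeHalf G p b := square_eq hG hb hc d1 d2 hbc d4.symm
  obtain ⟨e, he, hed, haway⟩ := exists_away hG hne d2
  rw [hpar] at haway
  obtain ⟨t, ht, htm, hsub⟩ := straight_end hG hne he
  refine ⟨t, ht, c, ?_, ?_, ?_⟩
  · rw [grom_zero_iff]
    intro h hht hhw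
    by_contra hch
    obtain ⟨y, hy1, hy2⟩ := hw.2.2 _ hhw _ hbw
    exact haway y (hsub h hht hch hy1) hy2
  · rw [grom_zero_iff]
    intro h hht hhw
    by_contra hch
    obtain ⟨y, hy1, hy2⟩ := hx.2.2 _ hhw _ hbx
    exact haway y (hsub h hht hch hy1) hy2
  · rw [grom_zero_iff]
    intro h hht hhw
    by_contra hch
    have hl : edgeHalf G c e ∈ x2 := ultra_up hG h2 hhw (isHalf_edge he) (hsub h hht hch)
    have hcp : p ∉ edgeHalf G c e := by
      intro hpm
      -- then the edge (c,p) is dual to it, so it is the complement of the half of (p,c)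
      have hpe : edgeHalf G c p = edgeHalf G c e :=
        djok hG (isHalf_edge he) hc.symm hpm not_mem_edgeHalf_left
      have hbm : b ∈ edgeHalf G c p := by
        have hbn : b ∉ edgeHalf G p c := by
          intro hbm
          simp only [edgeHalf, mem_ofPred_eq, dist_two hG hb hc hbc,
            SimpleGraph.dist_eq_one_iff_adj.mpr hb.symm] at hbm
          omega
        rw [← compl_edgeHalf hG hc]
        exact hbn
      rw [hpe] at hbm
      exact haway b hbm (mem_edgeHalf_right hb)
    have hep : e ∈ edgeHalf G p c := by
      have hne : e ≠ p := by
        rintro rfl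
        exact hcp (mem_edgeHalf_right he)
      simp only [edgeHalf, mem_ofPred_eq, dist_two hG he hc.symm hne,
        SimpleGraph.dist_eq_one_iff_adj.mpr he.symm]
      omega
    exact hdisj _ hcx _ hl not_mem_edgeHalf_left hcp e hep (mem_edgeHalf_right he)

/-- The auxiliary point `w` in the target. -/
lemma exists_w (hG : IsCCC G) (hne : NoExtremal G) {x1 x2 x u : Set (Set W)}
    (h1 : IsUltra G x1) (h2 : IsUltra G x2) (hx : IsUltra G x) (hu : IsUltra G u)
    {p : W} (h12 : grom G p x1 x2 = 0) (h1x : grom G p x1 x = 0) (h2x : grom G p x2 x = 0)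
    (hu1 : grom G p u x1 ≠ 0) (hu2 : grom G p u x2 ≠ 0) :
    ∃ w : Set (Set W), IsBdryPt G w ∧ grom G p x w = 0 ∧ grom G p x1 w ≠ 0 ∧
      grom G p x2 w ≠ 0 := by
  obtain ⟨b, hb, hbu, hb1⟩ := exists_adj_of_pos hG hu h1 hu1
  obtain ⟨c, hc, hcu, hc2⟩ := exists_adj_of_pos hG hu h2 hu2
  rw [grom_zero_iff] at h12 h1x h2x
  have hbc : b ≠ c := by
    rintro rfl
    exact not_mem_edgeHalf_left (h12 _ hb1 hc2)
  obtain ⟨z, hz1, hz2⟩ := hu.2.2 _ hbu _ hcu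
  obtain ⟨q, d1, d2, -, d4⟩ := quad hG hb hc hbc hz1 hz2
  have hparb : edgeHalf G c q = edgeHalf G p b := square_eq hG hb hc d1 d2 hbc d4.symm
  have hparc : edgeHalf G b q = edgeHalf G p c := square_eq hG hc hb d2 d1 hbc.symm d4.symm
  have hbx : edgeHalf G p b ∉ x := fun h => not_mem_edgeHalf_left (h1x _ hb1 h)
  have hcx : edgeHalf G p c ∉ x := fun h => not_mem_edgeHalf_left (h2x _ hc2 h)
  have hqb : q ∈ edgeHalf G p b := hparb ▸ mem_edgeHalf_right d2
  have hqc : q ∈ edgeHalf G p c := hparc ▸ mem_edgeHalf_right d1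
  obtain ⟨e, he, hed, haway⟩ := exists_away hG hne d2.symm
  have hsubb : edgeHalf G q e ⊆ edgeHalf G p b := by
    intro y hy
    have := haway y hy
    rw [← compl_edgeHalf hG d2, hparb] at this
    simpa using this
  obtain ⟨w, hw, hwm, hsub⟩ := straight_end hG hne he
  have hbw : edgeHalf G p b ∈ w := ultra_up hG hw.1 hwm (isHalf_edge hb) hsubb
  have hcw : edgeHalf G p c ∈ w := by
    rw [hw.1.2.1 _ (isHalf_edge hc)]
    intro hcc
    have hs := hsub _ hcc (by simpa using hqc)
    have hpm : p ∈ (edgeHalf G p c)ᶜ := not_mem_edgeHalf_left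
    exact not_mem_edgeHalf_left (hsubb (hs hpm))
  refine ⟨w, hw, ?_, ?_, ?_⟩
  · rw [grom_zero_iff]
    intro h hhx hhw
    by_contra hph
    by_cases hqh : q ∈ h
    · by_cases hbh : b ∈ h
      · have := djok hG (hx.1 h hhx) hb hbh hph
        exact hbx (this ▸ hhx)
      · have := djok hG (hx.1 h hhx) d1 hqh hbh
        rw [hparc] at this
        exact hcx (this ▸ hhx)
    · exact hbx (ultra_up hG hx hhx (isHalf_edge hb) ((hsub h hhw hqh).trans hsubb))
  · rw [Ne, grom_zero_iff]
    exact fun h => not_mem_edgeHalf_left (h _ hb1 hbw)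
  · rw [Ne, grom_zero_iff]
    exact fun h => not_mem_edgeHalf_left (h _ hc2 hcw)

lemma toE_top : toE ⊤ = ⊤ := by simp [toE]

lemma toE_nat (n : ℕ) : toE (n : ℕ∞) = ((n : ℝ) : EReal) := by
  simp only [toE, ENat.toENNReal_coe]
  rfl

lemma toE_nn (n m : ℕ) : toE (n : ℕ∞) - toE (m : ℕ∞) = (((n : ℝ) - m : ℝ) : EReal) := by
  rw [toE_nat, toE_nat, EReal.coe_sub]

lemma toE_tn (m : ℕ) : toE ⊤ - toE (m : ℕ∞) = ⊤ := by
  rw [toE_nat, toE_top]; exact EReal.top_sub_coe _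

lemma toE_nt (m : ℕ) : toE (m : ℕ∞) - toE ⊤ = ⊥ := by
  rw [toE_nat, toE_top]; simp [sub_eq_add_neg]

lemma toE_zero : toE 0 = 0 := by simp [toE]

lemma toE_diff {b c B C : ℕ∞} (h : toE C - toE B = toE c - toE b)
    (h1 : b ≠ ⊤ ∨ c ≠ ⊤) (h2 : B ≠ ⊤ ∨ C ≠ ⊤) :
    (b = ⊤ ↔ B = ⊤) ∧ (c = ⊤ ↔ C = ⊤) ∧ C + b = c + B := by
  induction b using ENat.recTopCoe <;> induction c using ENat.recTopCoe <;>
  induction B using ENat.recTopCoe <;> induction C using ENat.recTopCoe <;>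
  simp only [toE_nn, toE_tn, toE_nt] at h <;>
  first
    | (exact absurd h (EReal.coe_ne_top _))
    | (exact absurd h.symm (EReal.coe_ne_top _))
    | (exact absurd h (EReal.coe_ne_bot _))
    | (exact absurd h.symm (EReal.coe_ne_bot _))
    | (exfalso; simp at h1; done)
    | (exfalso; simp at h2; done)
    | (exfalso; simp at h; done)
    | (simp; done)
    | skip
  rename_i b c B C
  refine ⟨by simp, by simp, ?_⟩
  rw [EReal.coe_eq_coe_iff] at h
  have : ((C : ℝ) + b) = c + B := by linarith
  exact_mod_cast this

lemma arith {a b c A B C : ℕ∞} (hcb : toE C - toE B = toE c - toE b)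
    (hab : toE A - toE B = toE a - toE b) (hac : toE A - toE C = toE a - toE c)
    (h1 : b ≠ ⊤ ∨ c ≠ ⊤) (h2 : b ≠ ⊤ ∨ a ≠ ⊤) (h3 : c ≠ ⊤ ∨ a ≠ ⊤)
    (H1 : B ≠ ⊤ ∨ C ≠ ⊤) (H2 : B ≠ ⊤ ∨ A ≠ ⊤) (H3 : C ≠ ⊤ ∨ A ≠ ⊤)
    (hz : b = 0 ∨ c = 0) (hZ : A = 0 ∨ B = 0 ∨ C = 0) : b = B ∧ c = C := by
  obtain ⟨p1, p2, p3⟩ := toE_diff hcb h1 H1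
  obtain ⟨-, q2, q3⟩ := toE_diff hab h2 H2
  obtain ⟨-, -, r3⟩ := toE_diff hac h3 H3
  clear hcb hab hac
  induction b using ENat.recTopCoe <;> induction c using ENat.recTopCoe <;>
  induction B using ENat.recTopCoe <;> induction C using ENat.recTopCoe <;>
  induction a using ENat.recTopCoe <;> induction A using ENat.recTopCoe <;>
  simp_all <;> norm_cast at * <;> omega

lemma toE_sub3 {a b c : ℕ∞} (hb : b ≠ ⊤) (hc : c ≠ ⊤) :
    toE a - toE b - toE c = toE a - toE (b + c) := by
  lift b to ℕ using hb
  lift c to ℕ using hc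
  rw [← Nat.cast_add]
  induction a using ENat.recTopCoe with
  | top => rw [toE_tn, toE_tn, ← toE_top, toE_tn, toE_top]
  | coe a =>
    rw [toE_nn, toE_nn, toE_nat, ← EReal.coe_sub]
    congr 1
    push_cast
    ring

lemma toE_add (a b : ℕ∞) : toE (a + b) = toE a + toE b := by
  simp [toE]

/-- Finiteness of the Gromov product (independent of the basepoint). -/
def Fin2 (G : SimpleGraph W) (x y : Set (Set W)) : Prop := ∀ v : W, grom G v x y ≠ ⊤

lemma Fin2.symm {x y : Set (Set W)} (h : Fin2 G x y) : Fin2 G y x := fun v => by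
  rw [grom_comm]; exact h v

lemma fin2_of (hG : IsCCC G) {x y : Set (Set W)} (hx : IsUltra G x) {v : W}
    (h : grom G v x y ≠ ⊤) : Fin2 G x y := grom_fin hG hx h

lemma fin2_of_zero (hG : IsCCC G) {x y : Set (Set W)} (hx : IsUltra G x) {v : W}
    (h : grom G v x y = 0) : Fin2 G x y := grom_fin hG hx (v := v) (by rw [h]; simp)

/-- swap the middle entries -/
lemma memA_swap23 {x y z w : Set (Set W)} (h : memA G x y z w) : memA G x z y w := by
  intro v
  have := h v
  unfold inA tripod at *
  simp only [grom_comm (G := G) v z y] at *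
  tauto

lemma memA_swap12 {x y z w : Set (Set W)} (h : memA G x y z w) : memA G y x z w := by
  intro v
  have := h v
  unfold inA tripod at *
  simp only [grom_comm (G := G) v y x, add_comm (grom G v y z), add_comm (grom G v y w)] at *
  tauto

lemma memA_swap34 {x y z w : Set (Set W)} (h : memA G x y z w) : memA G x y w z := by
  intro v
  have := h v
  unfold inA tripod at *
  simp only [grom_comm (G := G) v w z] at *
  tauto

variable {W' : Type*} {G' : SimpleGraph W'}

lemma mob_fin {f : Bdry G → Bdry G'} (hmob : Mobius G G' f) {x y : Bdry G}
    (h : Fin2 G x.1 y.1) : Fin2 G' (f x).1 (f y).1 := by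
  have hA : memA G x.1 x.1 y.1 y.1 := fun v => by
    right; right
    simp [tripod, h v]
  have := (hmob x x y y hA).1
  intro v
  have hv := this v
  unfold inA tripod at hv
  simp only [ENat.add_eq_top, ne_eq, not_or] at hv
  tauto

lemma two_of_three {a b c : Prop} (h : (a ∧ b) ∨ (a ∧ c) ∨ (b ∧ c)) :
    (b ∨ c) ∧ (a ∨ c) ∧ (a ∨ b) := by
  tauto

/-- the core comparison -/
lemma core (f : Bdry G → Bdry G') (hmob : Mobius G G' f) (x1 x2 x y : Bdry G)
    {p : W} (hp : med x1.1 x2.1 x.1 = princ G p)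
    {p' : W'} (hp' : med (f x1).1 (f x2).1 (f x).1 = princ G' p')
    (hA : memA G x1.1 x2.1 x.1 y.1)
    (hz : grom G p x1.1 y.1 = 0 ∨ grom G p x2.1 y.1 = 0)
    (hZ : grom G' p' (f x).1 (f y).1 = 0 ∨ grom G' p' (f x1).1 (f y).1 = 0 ∨
      grom G' p' (f x2).1 (f y).1 = 0) :
    grom G p x1.1 y.1 = grom G' p' (f x1).1 (f y).1 ∧
    grom G p x2.1 y.1 = grom G' p' (f x2).1 (f y).1 := by
  obtain ⟨z1, z2, z3⟩ := med_zero hp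
  obtain ⟨Z1, Z2, Z3⟩ := med_zero hp'
  obtain ⟨hB, e1⟩ := hmob _ _ _ _ hA
  have e2 := (hmob _ _ _ _ (memA_swap23 hA)).2 p p'
  have e3 := (hmob _ _ _ _ (memA_swap23 (memA_swap12 hA))).2 p p'
  have e1 := e1 p p'
  have z1' := z1
  have Z1' := Z1
  rw [grom_comm] at z1' Z1'
  have z2' := z2
  have Z2' := Z2
  rw [grom_comm] at z2' Z2'
  have z3' := z3
  have Z3' := Z3
  rw [grom_comm] at z3' Z3'
  simp only [crv, z1, z2, z3, Z1, Z2, Z3, z1', z2', z3', Z1', Z2', Z3', toE_zero, zero_add,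
    sub_zero] at e1 e2 e3
  have a := hA p
  have A := hB p'
  unfold inA tripod at a A
  simp only [z1, z2, z3, Z1, Z2, Z3, zero_add, add_zero] at a A
  obtain ⟨a1, a2, a3⟩ := two_of_three a
  obtain ⟨A1, A2, A3⟩ := two_of_three A
  exact arith e1 e2 e3 a1.symm a2.symm a3.symm A1.symm A2.symm A3.symm hz hZ

/-- If `w` has positive product with `x1` and infinite product with `x`, so do the images. -/
lemma inf_pres (hG : IsCCC G) (hne : NoExtremal G) (f : Bdry G → Bdry G')
    (hG' : IsCCC G') (hmob : Mobius G G' f) (x1 x2 x w : Bdry G)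
    {p : W} (hdisj : ∀ h ∈ x1.1, ∀ k ∈ x2.1, p ∉ h → p ∉ k → ∀ z, z ∈ h → z ∈ k → False)
    (h12 : grom G p x1.1 x2.1 = 0) (h1x : grom G p x1.1 x.1 = 0) (h2x : grom G p x2.1 x.1 = 0)
    (hw1 : grom G p x1.1 w.1 ≠ 0) (hw2 : grom G p x2.1 w.1 ≠ ⊤) (hwx : grom G p x.1 w.1 = ⊤)
    (p' : W') : grom G' p' (f x).1 (f w).1 = ⊤ := by
  by_contra hcon
  obtain ⟨t, ht, q, t1, t2, t3⟩ := exists_t hG hne x1.2.1 x2.2.1 x.2.1 w.2.1 hdisj h12 h1x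
    (by rwa [grom_comm]) (by rw [grom_comm, hwx]; simp)
  have F1 : Fin2 G w.1 t := (fin2_of_zero hG ht.1 t1).symm
  have F2 : Fin2 G x.1 t := (fin2_of_zero hG ht.1 t2).symm
  have F3 : Fin2 G x2.1 t := (fin2_of_zero hG ht.1 t3).symm
  have F4 : Fin2 G x2.1 w.1 := fin2_of hG x2.2.1 hw2
  have F5 : Fin2 G x.1 x2.1 := (fin2_of_zero hG x2.2.1 h2x).symm
  have hA : memA G x.1 x2.1 w.1 t := fun v => by
    right; left
    simp only [tripod, ENat.add_eq_top, ne_eq, not_or]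
    exact ⟨⟨F5 v, F1 v⟩, F2 v, F4 v⟩
  have e := (hmob x x2 w ⟨t, ht⟩ hA).2 p p'
  have K2 := mob_fin hmob (y := ⟨t, ht⟩) F2
  have K3 := mob_fin hmob (y := ⟨t, ht⟩) F3
  have K4 := mob_fin hmob F4
  unfold crv at e
  rw [← toE_add, ← toE_add, toE_sub3 (K2 p') (K4 p'), toE_sub3 (F2 p) (F4 p)] at e
  have := (toE_diff e (Or.inl (by simpa using ⟨F2 p, F4 p⟩))
    (Or.inl (by simpa using ⟨K2 p', K4 p'⟩))).2.1
  rw [hwx] at this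
  simp only [top_add, true_iff, ENat.add_eq_top] at this
  exact this.elim hcon (K3 p')

end Main

end CCCR
open CCCR
/-- Lemma `more preserved products`: with `x1 op_x x2`,
`m_x = m(x1,x2,x) ∈ X` and `m'_x = m(f(x1),f(x2),f(x)) ∈ Y`, if the 4-tuples
`(x1,x2,u,v)`, `(x1,x2,x,u)`, `(x1,x2,x,v)` lie in `𝒜(X)`, then
`(u·v)_{m_x} = (f(u)·f(v))_{m'_x}`. -/
theorem stmt9 {V V' : Type*} (G : SimpleGraph V) (G' : SimpleGraph V')
    (hG : IsCCC G) (hG' : IsCCC G') (hne : NoExtremal G) (hne' : NoExtremal G')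
    (f : Bdry G → Bdry G') (hbij : Function.Bijective f) (hmob : Mobius G G' f)
    (x1 x2 x : Bdry G) (hop : Op G x1.1 x2.1 x.1)
    (p : V) (hp : med x1.1 x2.1 x.1 = princ G p)
    (p' : V') (hp' : med (f x1).1 (f x2).1 (f x).1 = princ G' p')
    (u v : Bdry G)
    (hA1 : memA G x1.1 x2.1 u.1 v.1) (hA2 : memA G x1.1 x2.1 x.1 u.1)
    (hA3 : memA G x1.1 x2.1 x.1 v.1) :
    grom G p u.1 v.1 = grom G' p' (f u).1 (f v).1 := by
  obtain ⟨z12, z2x, z1x⟩ := med_zero hp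
  obtain ⟨Z12, Z2x, Z1x⟩ := med_zero hp'
  have hdisj : ∀ h ∈ x1.1, ∀ k ∈ x2.1, p ∉ h → p ∉ k → ∀ z, z ∈ h → z ∈ k → False :=
    fun h hh k hk a b => op_disj hG x1.2.1 x2.2.1 hop hp hh hk a b
  -- one of the products with x1, x2 vanishes at p
  have hmin : ∀ y : Bdry G, grom G p x1.1 y.1 = 0 ∨ grom G p x2.1 y.1 = 0 := by
    intro y
    by_contra hcon
    push Not at hcon
    obtain ⟨b, hb, b1, b2⟩ := exists_adj_of_pos hG x1.2.1 y.2.1 hcon.1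
    obtain ⟨c, hc, c1, c2⟩ := exists_adj_of_pos hG x2.2.1 y.2.1 hcon.2
    obtain ⟨z, hz1, hz2⟩ := y.2.1.2.2 _ b2 _ c2
    exact hdisj _ b1 _ c1 not_mem_edgeHalf_left not_mem_edgeHalf_left z hz1 hz2
  have hmin' : ∀ y : Bdry G, grom G' p' (f x1).1 (f y).1 = 0 ∨
      grom G' p' (f x2).1 (f y).1 = 0 := by
    intro y
    by_contra hcon
    push Not at hcon
    obtain ⟨w', hw', w0, w1, w2⟩ := exists_w hG' hne' (f x1).2.1 (f x2).2.1 (f x).2.1 (f y).2.1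
      Z12 Z1x Z2x (by rw [grom_comm]; exact hcon.1) (by rw [grom_comm]; exact hcon.2)
    obtain ⟨w, hw⟩ := hbij.2 ⟨w', hw'⟩
    have hwv : (f w).1 = w' := by rw [hw]
    rw [← hwv] at w0 w1 w2
    by_cases hA : memA G x1.1 x2.1 x.1 w.1
    · have := core f hmob x1 x2 x w hp hp' hA (hmin w) (Or.inl w0)
      rcases hmin w with h | h
      · exact w1 (this.1.symm.trans h)
      · exact w2 (this.2.symm.trans h)
    · have hfin : ∀ a : Bdry G, grom G p a.1 w.1 ≠ ⊤ → ∀ q, grom G q a.1 w.1 ≠ ⊤ :=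
        fun a h => grom_fin hG a.2.1 h
      have f12 := fin2_of_zero hG x1.2.1 z12
      have f1x := fin2_of_zero hG x1.2.1 z1x
      have f2x := fin2_of_zero hG x2.2.1 z2x
      have hbad : ¬ (grom G p x.1 w.1 ≠ ⊤) ∧ ((grom G p x1.1 w.1 = 0 ∧ grom G p x2.1 w.1 = ⊤) ∨
          (grom G p x2.1 w.1 = 0 ∧ grom G p x1.1 w.1 = ⊤)) := by
        by_contra hno
        apply hA
        intro q
        have g := hfin x
        have g1 := hfin x1
        have g2 := hfin x2
        unfold inA tripod
        simp only [ENat.add_eq_top, ne_eq, not_or]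
        have k1 := f12 q
        have k2 := f1x q
        have k3 := f2x q
        have hz1 : grom G p x1.1 w.1 = 0 → grom G p x1.1 w.1 ≠ ⊤ := fun h => by rw [h]; simp
        have hz2 : grom G p x2.1 w.1 = 0 → grom G p x2.1 w.1 ≠ ⊤ := fun h => by rw [h]; simp
        have := hmin w
        by_cases a0 : grom G p x.1 w.1 = ⊤ <;> by_cases a1 : grom G p x1.1 w.1 = ⊤ <;>
          by_cases a2 : grom G p x2.1 w.1 = ⊤ <;> simp_all
      obtain ⟨hx, hbad⟩ := hbad
      rw [not_not] at hx
      rcases hbad with ⟨h0, ht⟩ | ⟨h0, ht⟩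
      · have := inf_pres hG hne f hG' hmob x2 x1 x w
          (fun h hh k hk a b z c d => hdisj k hk h hh b a z d c)
          (by rwa [grom_comm]) z2x z1x (by rw [ht]; simp) (by rw [h0]; simp) hx p'
        rw [w0] at this
        simp at this
      · have := inf_pres hG hne f hG' hmob x1 x2 x w hdisj
          z12 z1x z2x (by rw [ht]; simp) (by rw [h0]; simp) hx p'
        rw [w0] at this
        simp at this
  obtain ⟨u1, u2⟩ := core f hmob x1 x2 x u hp hp' hA2 (hmin u) (Or.inr (hmin' u))
  obtain ⟨v1, v2⟩ := core f hmob x1 x2 x v hp hp' hA3 (hmin v) (Or.inr (hmin' v))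
  have key : ∀ a b : Bdry G, memA G x1.1 x2.1 a.1 b.1 →
      grom G p x1.1 b.1 = grom G' p' (f x1).1 (f b).1 →
      grom G p x2.1 a.1 = grom G' p' (f x2).1 (f a).1 →
      grom G p x1.1 b.1 ≠ ⊤ → grom G p x2.1 a.1 ≠ ⊤ →
      grom G p a.1 b.1 = grom G' p' (f a).1 (f b).1 := by
    intro a b hA e1 e2 n1 n2
    have e := (hmob _ _ _ _ (memA_swap23 hA)).2 p p'
    unfold crv at e
    rw [z12, Z12, toE_zero, zero_add, zero_add, grom_comm p a.1 x2.1,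
      grom_comm p' (f a).1 (f x2).1, ← e1, ← e2, toE_sub3 n1 n2, toE_sub3 n1 n2] at e
    have hn : grom G p x1.1 b.1 + grom G p x2.1 a.1 ≠ ⊤ := by simpa using ⟨n1, n2⟩
    have := (toE_diff e (Or.inl hn) (Or.inl hn)).2.2
    exact (ENat.add_left_injective_of_ne_top hn this).symm
  have h1 := hA1 p
  unfold inA tripod at h1
  simp only [ENat.add_eq_top, ne_eq, not_or] at h1
  by_cases hc : grom G p x1.1 v.1 ≠ ⊤ ∧ grom G p x2.1 u.1 ≠ ⊤
  · exact key u v hA1 v1 u2 hc.1 hc.2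
  · rw [grom_comm p u.1 v.1, grom_comm p' (f u).1 (f v).1]
    refine key v u (memA_swap34 hA1) u1 v2 ?_ ?_ <;> tauto
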